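/- arXiv:1209.3588 — 2 statements merged into one kernel-verified Lean document; each statement's English description precedes it below -/
import Mathlib

section
/- Fix s > 0 and define, for p ∈ (0,1), h(p) = (p/(1 − p²))·((1 + exp(−ps))/(1 − exp(−ps))) and φ(p) = exp(ps)·(1 + 2/(p·h(p) + Real.sqrt (h(p)² + 1/(1 − p²)) − 1)). Then φ is strictly increasing on the interval (0,1). -/
/-- `sinh` is strictly convex on the nonnegative half-line. -/
theorem strictConvexOn_sinh_Ici : StrictConvexOn ℝ (Set.Ici 0) Real.sinh := by
  refine strictConvexOn_of_deriv2_pos (convex_Ici 0) Real.continuous_sinh.continuousOn ?_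
  intro x hx
  rw [interior_Ici] at hx
  simpa using hx

theorem strictAntiOn_div_sinh {k : ℝ} (hk : 0 < k) :
    StrictAntiOn (fun p : ℝ => p / Real.sinh (p * k)) (Set.Ioi 0) := by
  intro a ha b hb hab
  have ha' : 0 < a * k := mul_pos ha hk
  have hb' : 0 < b * k := mul_pos hb hk
  have hlt := strictConvexOn_sinh_Ici.secant_strict_mono (a := 0) (Set.self_mem_Ici)
    ha'.le hb'.le ha'.ne' hb'.ne' (mul_lt_mul_of_pos_right hab hk)
  simp only [Real.sinh_zero, sub_zero] at hlt
  rw [div_lt_div_iff₀ ha' hb'] at hlt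
  change b / _ < a / _
  rw [div_lt_div_iff₀ (Real.sinh_pos_iff.2 hb') (Real.sinh_pos_iff.2 ha')]
  refine lt_of_mul_lt_mul_right ?_ hk.le
  linarith

theorem ratio_mul_eq_of_sq_eq {p c R : ℝ} (hp : p ∈ Set.Ioo (0 : ℝ) 1) (hc : 1 < c)
    (hR : 1 < R) (hRc : R ^ 2 = 1 + p ^ 2 * (c ^ 2 - 1)) :
    (c + 1) / (c - 1) * (1 + 2 / (p * (p / (1 - p ^ 2) * c) + R / (1 - p ^ 2) - 1)) =
      1 + 2 / (R - 1) := by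
  have hq : 0 < 1 - p ^ 2 := by nlinarith [hp.1, hp.2]
  have hE : 0 < p ^ 2 * (c + 1) + (R - 1) := by
    have : 0 ≤ p ^ 2 * (c + 1) := by positivity
    linarith
  have hden : p * (p / (1 - p ^ 2) * c) + R / (1 - p ^ 2) - 1 =
      (p ^ 2 * (c + 1) + (R - 1)) / (1 - p ^ 2) := by
    field_simp
    ring
  have hc' : c - 1 ≠ 0 := by linarith
  have hR' : R - 1 ≠ 0 := by linarith
  have hE' := hE.ne'
  rw [hden]
  generalize hEdef : p ^ 2 * (c + 1) + (R - 1) = E at hE'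
  have hq' := hq.ne'
  field_simp
  subst hEdef
  linear_combination 2 * hRc

theorem exp_mul_eq_sqrt_form {s p : ℝ} (hs : 0 < s) (hp : p ∈ Set.Ioo (0 : ℝ) 1) :
    Real.exp (p * s) * (1 + 2 / (p * (p / (1 - p ^ 2) *
        ((1 + Real.exp (-(p * s))) / (1 - Real.exp (-(p * s))))) +
      Real.sqrt ((p / (1 - p ^ 2) *
        ((1 + Real.exp (-(p * s))) / (1 - Real.exp (-(p * s))))) ^ 2 + 1 / (1 - p ^ 2)) - 1)) =
      1 + 2 / (Real.sqrt (1 + (p / Real.sinh (p * (s / 2))) ^ 2) - 1) := by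
  have hp0 := hp.1
  have hq : 0 < 1 - p ^ 2 := by nlinarith [hp.1, hp.2]
  have hx : 0 < p * s := mul_pos hp0 hs
  have hS : 0 < Real.sinh (p * (s / 2)) := Real.sinh_pos_iff.2 (by positivity)
  have he0 := Real.exp_pos (-(p * s))
  have he1 : Real.exp (-(p * s)) < 1 := Real.exp_lt_one_iff.2 (by linarith)
  have hexp : Real.exp (p * s) = (Real.exp (-(p * s)))⁻¹ := by rw [← Real.exp_neg, neg_neg]
  have hsinh : Real.sinh (p * (s / 2)) ^ 2 * (4 * Real.exp (-(p * s))) =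
      (1 - Real.exp (-(p * s))) ^ 2 := by
    have h1 : Real.exp (-(p * s)) = Real.exp (-(p * (s / 2))) ^ 2 := by
      rw [← Real.exp_nat_mul]
      congr 1
      push_cast
      ring
    have h2 : Real.exp (p * (s / 2)) * Real.exp (-(p * (s / 2))) = 1 := by
      rw [← Real.exp_add, add_neg_cancel, Real.exp_zero]
    rw [h1, Real.sinh_eq]
    set u := Real.exp (p * (s / 2))
    set v := Real.exp (-(p * (s / 2)))
    linear_combination (u * v + 1 - 2 * v ^ 2) * h2
  rw [hexp]
  generalize Real.exp (-(p * s)) = e at *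
  generalize Real.sinh (p * (s / 2)) = S at *
  have he' : 1 - e ≠ 0 := by linarith
  have hc : 1 < (1 + e) / (1 - e) := by
    rw [one_lt_div (by linarith)]
    linarith
  have hratio : e⁻¹ = ((1 + e) / (1 - e) + 1) / ((1 + e) / (1 - e) - 1) := by
    have : (1 + e) / (1 - e) - 1 = 2 * e / (1 - e) := by field_simp; ring
    rw [this]
    field_simp
    ring
  have hcS : (p / S) ^ 2 = p ^ 2 * (((1 + e) / (1 - e)) ^ 2 - 1) := by
    field_simp
    linear_combination -hsinh
  rw [hratio]
  generalize (1 + e) / (1 - e) = c at *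
  have hR : 1 < Real.sqrt (1 + (p / S) ^ 2) := by
    rw [Real.lt_sqrt zero_le_one]
    have : 0 < (p / S) ^ 2 := by positivity
    linarith
  have hsqrt : Real.sqrt ((p / (1 - p ^ 2) * c) ^ 2 + 1 / (1 - p ^ 2)) =
      Real.sqrt (1 + (p / S) ^ 2) / (1 - p ^ 2) := by
    rw [← Real.sqrt_sq hq.le, ← Real.sqrt_div (by positivity), Real.sqrt_sq hq.le, hcS]
    congr 1
    field_simp
    ring
  rw [hsqrt]
  refine ratio_mul_eq_of_sq_eq hp hc hR ?_
  rw [Real.sq_sqrt (by positivity), hcS]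

/-- the auxiliary function `φ` is strictly increasing on `(0,1)`. -/
theorem stmt12 (s : ℝ) (hs : 0 < s) (h φ : ℝ → ℝ)
    (hh : ∀ p ∈ Set.Ioo (0 : ℝ) 1,
      h p = p / (1 - p ^ 2) * ((1 + Real.exp (-(p * s))) / (1 - Real.exp (-(p * s)))))
    (hφ : ∀ p ∈ Set.Ioo (0 : ℝ) 1,
      φ p = Real.exp (p * s) *
        (1 + 2 / (p * h p + Real.sqrt ((h p) ^ 2 + 1 / (1 - p ^ 2)) - 1))) :
    StrictMonoOn φ (Set.Ioo (0 : ℝ) 1) := by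
  intro a ha b hb hab
  rw [hφ a ha, hφ b hb, hh a ha, hh b hb, exp_mul_eq_sqrt_form hs ha, exp_mul_eq_sqrt_form hs hb]
  have hlt : b / Real.sinh (b * (s / 2)) < a / Real.sinh (a * (s / 2)) :=
    strictAntiOn_div_sinh (half_pos hs) ha.1 hb.1 hab
  have hpos : 0 < b / Real.sinh (b * (s / 2)) :=
    div_pos hb.1 (Real.sinh_pos_iff.2 (mul_pos hb.1 (half_pos hs)))
  have hR : 1 < Real.sqrt (1 + (b / Real.sinh (b * (s / 2))) ^ 2) := by
    rw [Real.lt_sqrt zero_le_one]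
    linarith [pow_pos hpos 2]
  have hRR : Real.sqrt (1 + (b / Real.sinh (b * (s / 2))) ^ 2) <
      Real.sqrt (1 + (a / Real.sinh (a * (s / 2))) ^ 2) :=
    Real.sqrt_lt_sqrt (by positivity) (by gcongr)
  have := div_lt_div_of_pos_left two_pos (sub_pos.2 hR) (sub_lt_sub_right hRR 1)
  linarith
end

section
/- Let α > 1 be a real number and s a real number with cos s ≠ 1. Then the maximum over θ ∈ ℝ of (α + cos(θ − s))/(α + cos θ) equals 1 + 2/(Real.sqrt (2(α² − 1)/(1 − cos s) + 1) − 1). Moreover this maximum is at most (α + 1)/(α − 1), with equality if and only if cos s = −1 (i.e. s ≡ π mod 2π). -/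
noncomputable section

/-- A sinusoid `a cos θ + b sin θ` of amplitude `A > 0` attains the value `A`. -/
theorem exists_mul_cos_add_mul_sin_eq {a b A : ℝ} (hA : 0 < A) (h : a ^ 2 + b ^ 2 = A ^ 2) :
    ∃ θ : ℝ, a * Real.cos θ + b * Real.sin θ = A := by
  have hnorm : ‖(⟨a, b⟩ : ℂ)‖ = A := by
    rw [Complex.norm_eq_sqrt_sq_add_sq, h, Real.sqrt_sq hA.le]
  have hne : (⟨a, b⟩ : ℂ) ≠ 0 := by
    rw [← norm_pos_iff, hnorm]
    exact hA
  refine ⟨Complex.arg ⟨a, b⟩, ?_⟩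
  rw [Complex.cos_arg hne, Complex.sin_arg, hnorm]
  field_simp
  exact h

/-- A sinusoid `a cos θ + b sin θ` is bounded by its amplitude. -/
theorem mul_cos_add_mul_sin_le {a b A : ℝ} (hA : 0 ≤ A) (h : a ^ 2 + b ^ 2 = A ^ 2) (θ : ℝ) :
    a * Real.cos θ + b * Real.sin θ ≤ A := by
  refine le_of_sq_le_sq ?_ hA
  rw [← h]
  linear_combination sq_nonneg (a * Real.sin θ - b * Real.cos θ) +
    (a ^ 2 + b ^ 2) * Real.sin_sq_add_cos_sq θ

/-- If `M > 1` satisfies the amplitude equation `2 M (1 - cos s) = (α² - 1) (M - 1)²`, then `M` is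
the maximum of `(α + cos (θ - s)) / (α + cos θ)`. -/
theorem isGreatest_range_add_cos_sub_div {α s M : ℝ} (hα : 1 < α) (hM : 1 < M)
    (h : 2 * M * (1 - Real.cos s) = (α ^ 2 - 1) * (M - 1) ^ 2) :
    IsGreatest (Set.range fun θ : ℝ => (α + Real.cos (θ - s)) / (α + Real.cos θ)) M := by
  have hden (θ : ℝ) : 0 < α + Real.cos θ := by linarith [Real.neg_one_le_cos θ]
  have hA : 0 < α * (M - 1) := mul_pos (by linarith) (by linarith)
  have hamp : (Real.cos s - M) ^ 2 + Real.sin s ^ 2 = (α * (M - 1)) ^ 2 := by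
    linear_combination h + Real.sin_sq_add_cos_sq s
  constructor
  · obtain ⟨θ, hθ⟩ := exists_mul_cos_add_mul_sin_eq hA hamp
    refine ⟨θ, ?_⟩
    rw [div_eq_iff (hden θ).ne', Real.cos_sub]
    linear_combination hθ
  · rintro _ ⟨θ, rfl⟩
    rw [div_le_iff₀ (hden θ), Real.cos_sub]
    linear_combination mul_cos_add_mul_sin_le hA.le hamp θ

/-- for `α > 1` and `cos s ≠ 1`, the maximum over `θ` of
`(α + cos(θ - s))/(α + cos θ)` equals `1 + 2/(√(2(α²-1)/(1-cos s) + 1) - 1)`;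
this maximum is at most `(α+1)/(α-1)`, with equality iff `cos s = -1`. -/
theorem stmt18 (α s : ℝ) (hα : 1 < α) (hs : Real.cos s ≠ 1) :
    IsGreatest (Set.range fun θ : ℝ => (α + Real.cos (θ - s)) / (α + Real.cos θ))
      (1 + 2 / (Real.sqrt (2 * (α ^ 2 - 1) / (1 - Real.cos s) + 1) - 1)) ∧
    1 + 2 / (Real.sqrt (2 * (α ^ 2 - 1) / (1 - Real.cos s) + 1) - 1) ≤
      (α + 1) / (α - 1) ∧
    (1 + 2 / (Real.sqrt (2 * (α ^ 2 - 1) / (1 - Real.cos s) + 1) - 1) =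
        (α + 1) / (α - 1) ↔ Real.cos s = -1) := by
  have hk : 0 < 1 - Real.cos s := sub_pos.2 ((Real.cos_le_one s).lt_of_ne hs)
  have hα2 : 0 < α ^ 2 - 1 := by nlinarith
  have hpos : 0 < 2 * (α ^ 2 - 1) / (1 - Real.cos s) := by positivity
  set R := Real.sqrt (2 * (α ^ 2 - 1) / (1 - Real.cos s) + 1) with hR
  have hR1 : 1 < R := by
    rw [hR, Real.lt_sqrt zero_le_one]
    linarith
  have hRsq : (R ^ 2 - 1) * (1 - Real.cos s) = 2 * (α ^ 2 - 1) := by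
    rw [hR, Real.sq_sqrt (by linarith)]
    field_simp
    ring
  have hR0 : 0 < R - 1 := sub_pos.2 hR1
  have hα0 : 0 < α - 1 := sub_pos.2 hα
  have hαR : α ≤ R := by
    refine le_of_sq_le_sq ?_ (by linarith)
    nlinarith [Real.neg_one_le_cos s]
  have hbound : (α + 1) / (α - 1) = 1 + 2 / (α - 1) := by
    field_simp
    ring
  refine ⟨isGreatest_range_add_cos_sub_div hα (by linarith [div_pos two_pos hR0]) ?_, ?_, ?_⟩
  · field_simp
    linear_combination 2 * hRsq
  · rw [hbound]
    gcongr
  · rw [hbound, add_right_inj, div_eq_div_iff hR0.ne' hα0.ne', mul_right_inj' two_ne_zero,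
      sub_left_inj, eq_comm]
    constructor
    · intro h
      rw [h] at hRsq
      have := mul_left_cancel₀ hα2.ne' (hRsq.trans (mul_comm _ _))
      linarith
    · intro h
      rw [h] at hRsq
      exact (sq_eq_sq₀ (by linarith) (by linarith)).1 (by linarith)
end
end
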